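/- Let k be an infinite field with char k = 0. If (1, 18, a, t, a, 18, 1) is the Hilbert function of a standard graded artinian Gorenstein k-algebra (for integers a, t), then a ≥ 18. -/

import Mathlib

open MvPolynomial

/-- The degree-`d` graded component of `R/I` (the image of the space of
degree-`d` homogeneous polynomials in the quotient), as a `k`-submodule. -/
noncomputable def gradedPiece (k : Type*) [Field k] (r : ℕ)
    (I : Ideal (MvPolynomial (Fin r) k)) (d : ℕ) :
    Submodule k (MvPolynomial (Fin r) k ⧸ I) :=
  Submodule.map (Ideal.Quotient.mkₐ k I).toLinearMap
    (homogeneousSubmodule (Fin r) k d)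

/-- The Hilbert function of `R/I` in degree `d`. -/
noncomputable def hilb (k : Type*) [Field k] (r : ℕ)
    (I : Ideal (MvPolynomial (Fin r) k)) (d : ℕ) : ℕ :=
  Module.finrank k (gradedPiece k r I d)

/-- `I` is a homogeneous ideal. -/
def IsHomogIdeal {k : Type*} [Field k] {r : ℕ}
    (I : Ideal (MvPolynomial (Fin r) k)) : Prop :=
  ∀ f ∈ I, ∀ n : ℕ, homogeneousComponent n f ∈ I

/-- `I` contains no nonzero linear forms. -/
def NoLinearForms {k : Type*} [Field k] {r : ℕ}
    (I : Ideal (MvPolynomial (Fin r) k)) : Prop :=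
  ∀ f ∈ I, f.IsHomogeneous 1 → f = 0

/-- The dimension of the degree-`i` component of the socle of `R/I`. -/
noncomputable def socDim (k : Type*) [Field k] (r : ℕ)
    (I : Ideal (MvPolynomial (Fin r) k)) (i : ℕ) : ℕ :=
  Module.finrank k (Submodule.map (Ideal.Quotient.mkₐ k I).toLinearMap
    (homogeneousSubmodule (Fin r) k i ⊓
      ⨅ j : Fin r, Submodule.comap (LinearMap.mulLeft k (X j))
        (Submodule.restrictScalars k I)))

/-- `R/I` is a standard graded artinian algebra:
`I` is homogeneous and `R/I` is finite-dimensional over `k`. -/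
def StdArtinian (k : Type*) [Field k] (r : ℕ)
    (I : Ideal (MvPolynomial (Fin r) k)) : Prop :=
  IsHomogIdeal I ∧ Module.Finite k (MvPolynomial (Fin r) k ⧸ I)

/-- `R/I` has socle degree `e`: `e` is the largest degree with nonzero
Hilbert function. -/
def SocleDegree (k : Type*) [Field k] (r : ℕ)
    (I : Ideal (MvPolynomial (Fin r) k)) (e : ℕ) : Prop :=
  hilb k r I e ≠ 0 ∧ ∀ j : ℕ, e < j → hilb k r I j = 0

/-- `R/I` is a standard graded artinian Gorenstein algebra of socle degree `e`:
the socle vanishes below degree `e` and is one-dimensional in degree `e`. -/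
def Gorenstein (k : Type*) [Field k] (r e : ℕ)
    (I : Ideal (MvPolynomial (Fin r) k)) : Prop :=
  StdArtinian k r I ∧ SocleDegree k r I e ∧
    (∀ i : ℕ, i < e → socDim k r I i = 0) ∧ socDim k r I e = 1

/-- `R/I` is a standard graded artinian level algebra of socle degree `e`. -/
def LevelAlg (k : Type*) [Field k] (r e : ℕ)
    (I : Ideal (MvPolynomial (Fin r) k)) : Prop :=
  StdArtinian k r I ∧ SocleDegree k r I e ∧
    (∀ i : ℕ, i < e → socDim k r I i = 0)

/-- The linear form with coefficient vector `c`. -/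
noncomputable def linForm {k : Type*} [Field k] {r : ℕ} (c : Fin r → k) :
    MvPolynomial (Fin r) k :=
  ∑ i, C (c i) * X i

/-- A property `P` holds for a general linear form: there is a nonempty
(basic) Zariski-open subset of the space of linear forms on which `P` holds. -/
def Generically (k : Type*) [Field k] (r : ℕ)
    (P : MvPolynomial (Fin r) k → Prop) : Prop :=
  ∃ Q : MvPolynomial (Fin r) k, Q ≠ 0 ∧
    ∀ c : Fin r → k, eval c Q ≠ 0 → P (linForm c)

/-- `R/I` has the weak Lefschetz property (socle degree `e`): multiplication
by some linear form has maximal rank from each degree `i < e` to degree `i+1`. -/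
def WLP (k : Type*) [Field k] (r e : ℕ)
    (I : Ideal (MvPolynomial (Fin r) k)) : Prop :=
  ∃ L : MvPolynomial (Fin r) k, L.IsHomogeneous 1 ∧
    ∀ i : ℕ, i < e →
      Module.finrank k (Submodule.map
        (LinearMap.mulLeft k (Ideal.Quotient.mk I L)) (gradedPiece k r I i)) =
      min (hilb k r I i) (hilb k r I (i + 1))

/-- The largest `t` with `choose t i ≤ n`: the leading top in the
`i`-binomial expansion of `n`. -/
noncomputable def binTop (n i : ℕ) : ℕ := sSup {t : ℕ | Nat.choose t i ≤ n}

/-- Auxiliary recursion computing `((n)_{(i)})⁻¹₀`, i.e. the sum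
`C(n_i - 1, i) + C(n_{i-1} - 1, i-1) + ⋯ + C(n_j - 1, j)` where
`n_{(i)} = C(n_i, i) + ⋯ + C(n_j, j)` is the `i`-binomial expansion of `n`. -/
noncomputable def greenBoundAux : ℕ → ℕ → ℕ
  | 0, _ => 0
  | (i + 1), n =>
    if n = 0 then 0 else
      Nat.choose (binTop n (i + 1) - 1) (i + 1) +
        greenBoundAux i (n - Nat.choose (binTop n (i + 1)) (i + 1))

/-- `greenBound n i = ((n)_{(i)})⁻¹₀`. -/
noncomputable def greenBound (n i : ℕ) : ℕ := greenBoundAux i n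

section
variable {k : Type*} [Field k]

/-- `f t` is, tested against every linear functional, a polynomial in `t` whose first two
coefficients are given by `a` and `b`. -/
def HasFirstOrderExpansion {Q : Type*} [AddCommGroup Q] [Module k Q] (f : k → Q) (a b : Q) :
    Prop :=
  ∀ g : Q →ₗ[k] k, ∃ p : Polynomial k,
    (∀ t, g (f t) = p.eval t) ∧ p.coeff 0 = g a ∧ p.coeff 1 = g b

theorem HasFirstOrderExpansion.affine {Q : Type*} [AddCommGroup Q] [Module k Q] (a b : Q) :
    HasFirstOrderExpansion (fun t : k => a + t • b) a b := by
  intro g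
  refine ⟨Polynomial.C (g a) + Polynomial.C (g b) * Polynomial.X, fun t => ?_, ?_, ?_⟩
  · simp only [map_add, map_smul, smul_eq_mul, Polynomial.eval_add, Polynomial.eval_mul,
      Polynomial.eval_C, Polynomial.eval_X]
    ring
  · simp
  · simp [Polynomial.coeff_C]

theorem HasFirstOrderExpansion.prodMk {Q Q' : Type*} [AddCommGroup Q] [Module k Q]
    [AddCommGroup Q'] [Module k Q'] {f : k → Q} {a b : Q} {f' : k → Q'} {a' b' : Q'}
    (h : HasFirstOrderExpansion f a b) (h' : HasFirstOrderExpansion f' a' b') :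
    HasFirstOrderExpansion (fun t => (f t, f' t)) (a, a') (b, b') := by
  intro g
  obtain ⟨p, hp, hp0, hp1⟩ := h (g ∘ₗ LinearMap.inl k Q Q')
  obtain ⟨q, hq, hq0, hq1⟩ := h' (g ∘ₗ LinearMap.inr k Q Q')
  have key : ∀ x y, g (x, y) = g (x, 0) + g (0, y) := fun x y => by
    rw [← map_add]; simp
  simp only [LinearMap.comp_apply, LinearMap.inl_apply, LinearMap.inr_apply] at *
  refine ⟨p + q, fun t => ?_, ?_, ?_⟩
  · rw [key, hp, hq, Polynomial.eval_add]
  · rw [key, Polynomial.coeff_add, hp0, hq0]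
  · rw [key, Polynomial.coeff_add, hp1, hq1]

theorem HasFirstOrderExpansion.pi {ι : Type*} [Fintype ι] {Q : Type*}
    [AddCommGroup Q] [Module k Q] {f : ι → k → Q} {a b : ι → Q}
    (h : ∀ i, HasFirstOrderExpansion (f i) (a i) (b i)) :
    HasFirstOrderExpansion (fun t i => f i t) a b := by
  classical
  intro g
  choose p hp hp0 hp1 using fun i => h i (g ∘ₗ LinearMap.single k (fun _ => Q) i)
  have key : ∀ x : ι → Q, g x = ∑ i, g (LinearMap.single k (fun _ => Q) i (x i)) := fun x => by
    rw [← map_sum]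
    congr 1
    ext j
    simp [Finset.sum_apply, Pi.single_apply]
  simp only [LinearMap.comp_apply] at *
  refine ⟨∑ i, p i, fun t => ?_, ?_, ?_⟩
  · rw [key, Polynomial.eval_finsetSum]
    exact Finset.sum_congr rfl fun i _ => hp i t
  · rw [key, Polynomial.finsetSum_coeff]
    simp [hp0]
  · rw [key, Polynomial.finsetSum_coeff]
    simp [hp1]

theorem HasFirstOrderExpansion.pow_mul {A Q : Type*} [CommRing A] [Algebra k A] [AddCommGroup Q]
    [Module k Q] (F : A →ₗ[k] Q) (ℓ x m : A) (e : ℕ) :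
    HasFirstOrderExpansion (fun t : k => F ((ℓ + t • x) ^ e * m)) (F (ℓ ^ e * m))
      (F (e * ℓ ^ (e - 1) * x * m)) := by
  intro g
  set p : Polynomial A := (Polynomial.C ℓ + Polynomial.X * Polynomial.C x) ^ e * Polynomial.C m
    with hp
  refine ⟨∑ j ∈ Finset.range (p.natDegree + 1), Polynomial.monomial j (g (F (p.coeff j))),
    fun t => ?_, ?_, ?_⟩
  · have h1 : (ℓ + t • x) ^ e * m = p.eval (algebraMap k A t) := by
      simp only [hp, Polynomial.eval_mul, Polynomial.eval_pow, Polynomial.eval_add,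
        Polynomial.eval_C, Polynomial.eval_X, Algebra.smul_def]
    simp only [h1]
    rw [Polynomial.eval_eq_sum_range, Polynomial.eval_finsetSum, map_sum, map_sum]
    refine Finset.sum_congr rfl fun j _ => ?_
    rw [Polynomial.eval_monomial, ← map_pow, mul_comm (p.coeff j), ← Algebra.smul_def, map_smul,
      map_smul, smul_eq_mul, mul_comm]
  · have h1 : p.coeff 0 = ℓ ^ e * m := by
      rw [Polynomial.coeff_zero_eq_eval_zero]; simp [hp]
    simp [Polynomial.finsetSum_coeff, Polynomial.coeff_monomial, h1]
  · have h1 : p.coeff 1 = e * ℓ ^ (e - 1) * x * m := by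
      have : p.coeff 1 = (Polynomial.derivative p).coeff 0 := by
        simp [Polynomial.coeff_derivative]
      rw [this, Polynomial.coeff_zero_eq_eval_zero]
      simp [hp, Polynomial.derivative_pow]
    simp only [Polynomial.finsetSum_coeff, Polynomial.coeff_monomial, Finset.sum_ite_eq',
      Finset.mem_range]
    split_ifs with h
    · rw [h1]
    · rw [← h1, Polynomial.coeff_eq_zero_of_natDegree_lt (by omega)]; simp

/-- For a polynomial family of linear maps over an infinite field, at a point of maximal rank the
first-order variation maps the kernel into the range. -/
theorem exists_firstOrder_ker_mem_range [Infinite k] {V P Q : Type*} [AddCommGroup V] [Module k V]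
    [AddCommGroup P] [Module k P] [FiniteDimensional k P] [AddCommGroup Q] [Module k Q]
    (Φ : V → P →ₗ[k] Q) (D : V → V → P → Q)
    (h : ∀ L X m, HasFirstOrderExpansion (fun t : k => Φ (L + t • X) m) (Φ L m) (D L X m)) :
    ∃ L, ∀ X m, Φ L m = 0 → D L X m ∈ LinearMap.range (Φ L) := by
  classical
  have hbdd : BddAbove (Set.range fun L => Module.finrank k (LinearMap.range (Φ L))) := by
    refine ⟨Module.finrank k P, ?_⟩
    rintro _ ⟨L, rfl⟩
    exact LinearMap.finrank_range_le _
  obtain ⟨L, hL⟩ := Nat.sSup_mem (Set.range_nonempty _) hbdd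
  have hmax : ∀ L', Module.finrank k (LinearMap.range (Φ L')) ≤
      Module.finrank k (LinearMap.range (Φ L)) := fun L' => by
    have := le_csSup hbdd ⟨L', rfl⟩
    simp only at hL
    rwa [← hL] at this
  refine ⟨L, fun X m hm => ?_⟩
  by_contra hD
  set n := Module.finrank k (LinearMap.range (Φ L)) with hn
  let B := Module.finBasisOfFinrankEq k (LinearMap.range (Φ L)) hn.symm
  choose e he using fun i => (B i).2
  have hB : LinearIndependent k fun i => (B i : Q) :=
    B.linearIndependent.map' (LinearMap.range (Φ L)).subtype (Submodule.ker_subtype _)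
  have hspan : Submodule.span k (Set.range fun i => (B i : Q)) = LinearMap.range (Φ L) := by
    have := congrArg (Submodule.map (LinearMap.range (Φ L)).subtype) B.span_eq
    rw [Submodule.map_span, ← Set.range_comp] at this
    simpa [Function.comp_def] using this
  have hv : LinearIndependent k (Fin.cons (D L X m) fun i => (B i : Q)) := by
    rw [linearIndependent_finCons]
    exact ⟨hB, by rwa [hspan]⟩
  set v : Fin (n + 1) → Q := Fin.cons (D L X m) fun i => (B i : Q) with hvdef
  obtain ⟨g, hg⟩ := LinearMap.exists_leftInverse_of_injective
    (Fintype.linearCombination k v)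
    (LinearMap.ker_eq_bot.2 (linearIndependent_iff_injective_fintypeLinearCombination.1 hv))
  have hgv : ∀ i j, g (v i) j = if i = j then 1 else 0 := fun i j => by
    have := congrFun (LinearMap.congr_fun hg (Pi.single i 1)) j
    simp [Fintype.linearCombination_apply_single, Pi.single_apply] at this
    simpa [eq_comm] using this
  choose p hp hp0 hp1 using fun (j : Fin (n + 1)) (w : P) => h L X w (LinearMap.proj j ∘ₗ g)
  let M : Matrix (Fin (n + 1)) (Fin (n + 1)) (Polynomial k) := Matrix.of fun i j =>
    Fin.cases ((p j m).divX) (fun i' => p j (e i')) i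
  have hM0 : (Polynomial.evalRingHom 0).mapMatrix M = 1 := by
    ext i j
    refine Fin.cases ?_ (fun i' => ?_) i
    · have := hp1 j m
      simp only [LinearMap.comp_apply, LinearMap.proj_apply] at this
      simp [M, ← Polynomial.coeff_zero_eq_eval_zero, Polynomial.coeff_divX, this,
        Matrix.one_apply]
      simpa [hvdef] using hgv 0 j
    · have := hp0 j (e i')
      simp only [LinearMap.comp_apply, LinearMap.proj_apply] at this
      simp [M, ← Polynomial.coeff_zero_eq_eval_zero, this, Matrix.one_apply, he]
      simpa [hvdef] using hgv i'.succ j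
  have hdet : M.det ≠ 0 := fun h0 => by
    have := RingHom.map_det (Polynomial.evalRingHom (0 : k)) M
    rw [hM0, h0] at this
    simp at this
  obtain ⟨t, ht⟩ : ∃ t : k, (M.det * Polynomial.X).eval t ≠ 0 := by
    by_contra! hall
    exact mul_ne_zero hdet Polynomial.X_ne_zero (Polynomial.funext (by simpa using hall))
  rw [Polynomial.eval_mul, Polynomial.eval_X] at ht
  have htd := left_ne_zero_of_mul ht
  have ht0 := right_ne_zero_of_mul ht
  let w : Fin (n + 1) → P := Fin.cons (t⁻¹ • m) e
  have hw : ∀ i j, g (Φ (L + t • X) (w i)) j = (M i j).eval t := fun i j => by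
    refine Fin.cases ?_ (fun i' => ?_) i
    · have h1 := hp j m t
      have h0 := hp0 j m
      simp only [LinearMap.comp_apply, LinearMap.proj_apply, hm, map_zero]
        at h1 h0
      have h2 := Polynomial.divX_mul_X_add (p j m)
      simp only [w, M, Fin.cons_zero, map_smul, Pi.smul_apply, h1, Matrix.of_apply,
        Fin.cases_zero, smul_eq_mul]
      rw [h0, map_zero, add_zero] at h2
      rw [← congrArg (Polynomial.eval t) h2, Polynomial.eval_mul, Polynomial.eval_X]
      field_simp
    · have h1 := hp j (e i') t
      simp only [LinearMap.comp_apply, LinearMap.proj_apply] at h1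
      simp [w, M, h1]
  have hli : LinearIndependent k fun i => Φ (L + t • X) (w i) := by
    refine LinearIndependent.of_comp g ?_
    have : (g ∘ fun i => Φ (L + t • X) (w i)) =
        ((Polynomial.evalRingHom t).mapMatrix M).row := by
      ext i j
      simp [hw, Matrix.row]
    rw [this]
    refine Matrix.linearIndependent_rows_of_det_ne_zero
      (A := (Polynomial.evalRingHom t).mapMatrix M) ?_
    rw [← RingHom.map_det]
    exact htd
  have hli' : LinearIndependent k fun i => (⟨Φ (L + t • X) (w i), ⟨_, rfl⟩⟩ :
      LinearMap.range (Φ (L + t • X))) :=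
    LinearIndependent.of_comp (LinearMap.range (Φ (L + t • X))).subtype hli
  have := hli'.fintype_card_le_finrank
  have := hmax (L + t • X)
  simp at *
  omega

variable {A : Type*} [CommRing A] [Algebra k A]

/-- There is an element `ℓ` of `V` that is general for the multiplication maps
`ℓ ^ e : V ^ i → A ⧸ N` and for the family `(M, Y) ↦ (ℓ ^ s * M, Z ↦ M * Z - ℓ * Y Z)`. -/
theorem exists_general_element [Infinite k] [FiniteDimensional k A] (V N : Submodule k A)
    (B s : ℕ) :
    ∃ ℓ ∈ V,
      (∀ i < B, ∀ e < B, ∀ n ∈ V ^ i, ℓ ^ e * n ∈ N → ∀ x ∈ V,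
        ∃ m ∈ V ^ i, e * ℓ ^ (e - 1) * x * n - ℓ ^ e * m ∈ N) ∧
      ∀ M ∈ V, ∀ Y : V →ₗ[k] V, ℓ ^ s * M = 0 → (∀ Z : V, M * Z - ℓ * Y Z = 0) → ∀ x ∈ V,
        ∃ M' ∈ V, ∃ Y' : V →ₗ[k] V, ℓ ^ s * M' = s * ℓ ^ (s - 1) * x * M ∧
          ∀ Z : V, M' * Z - ℓ * Y' Z = -(x * Y Z) := by
  let Φ : V → ((∀ j : Fin B × Fin B, ↥(V ^ (j.1 : ℕ))) × (V × (V →ₗ[k] V))) →ₗ[k]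
      ((Fin B × Fin B → A ⧸ N) × (A × (V → A))) := fun ℓ =>
    { toFun := fun p => (fun j => N.mkQ ((ℓ : A) ^ (j.2 : ℕ) * p.1 j), (ℓ : A) ^ s * p.2.1,
        fun Z => p.2.1 * Z - ℓ * p.2.2 Z)
      map_add' := fun p q => by
        refine Prod.ext ?_ (Prod.ext ?_ ?_)
        · ext j
          simp only [Prod.fst_add, Pi.add_apply, Submodule.coe_add, mul_add, map_add]
        · simp [mul_add]
        · ext Z
          simp only [Prod.snd_add, Prod.fst_add, Pi.add_apply, Submodule.coe_add,
            LinearMap.add_apply]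
          ring
      map_smul' := fun c p => by
        refine Prod.ext ?_ (Prod.ext ?_ ?_)
        · ext j
          simp only [Prod.smul_fst, Pi.smul_apply, Submodule.coe_smul, mul_smul_comm, map_smul,
            RingHom.id_apply]
        · simp
        · ext Z
          simp [smul_sub] }
  let D : V → V → ((∀ j : Fin B × Fin B, ↥(V ^ (j.1 : ℕ))) × (V × (V →ₗ[k] V))) →
      ((Fin B × Fin B → A ⧸ N) × (A × (V → A))) := fun ℓ x p =>
    (fun j => N.mkQ (((j.2 : ℕ) : A) * (ℓ : A) ^ ((j.2 : ℕ) - 1) * x * p.1 j),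
      s * (ℓ : A) ^ (s - 1) * x * p.2.1, fun Z => -(x * p.2.2 Z))
  obtain ⟨ℓ, hℓ⟩ := exists_firstOrder_ker_mem_range Φ D fun L X m => by
    refine HasFirstOrderExpansion.prodMk ?_ (HasFirstOrderExpansion.prodMk ?_ ?_)
    · exact HasFirstOrderExpansion.pi fun j =>
        HasFirstOrderExpansion.pow_mul N.mkQ (L : A) X (m.1 j) j.2
    · exact HasFirstOrderExpansion.pow_mul (LinearMap.id : A →ₗ[k] A) (L : A) X m.2.1 s
    · convert! HasFirstOrderExpansion.affine (k := k) (fun Z : V => (m.2.1 * Z - L * m.2.2 Z : A))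
        (fun Z : V => -(X * m.2.2 Z : A)) using 2 with t
      ext Z
      simp only [Submodule.coe_add, Submodule.coe_smul, Pi.add_apply, Pi.smul_apply]
      simp only [Algebra.smul_def]
      ring
  refine ⟨ℓ, ℓ.2, fun i hi e he n hn hnN x hx => ?_, fun M hM Y hsM hY x hx => ?_⟩
  · obtain ⟨p, hp⟩ := hℓ ⟨x, hx⟩ (fun j => if h : (j.1 : ℕ) = i ∧ (j.2 : ℕ) = e then
        ⟨n, h.1 ▸ hn⟩ else 0, 0) (by
      refine Prod.ext ?_ (Prod.ext ?_ ?_)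
      · ext j
        simp only [Φ, LinearMap.coe_mk, AddHom.coe_mk]
        split_ifs with h
        · simpa [h.2] using hnN
        · simp
      · simp [Φ]
      · ext Z
        simp [Φ])
    refine ⟨p.1 (⟨i, hi⟩, ⟨e, he⟩), (p.1 (⟨i, hi⟩, ⟨e, he⟩)).2, ?_⟩
    have := congrFun (congrArg Prod.fst hp) (⟨i, hi⟩, ⟨e, he⟩)
    simp only [Φ, D, LinearMap.coe_mk, AddHom.coe_mk, and_self, dif_pos] at this
    rw [← Submodule.Quotient.mk_eq_zero, Submodule.Quotient.mk_sub, sub_eq_zero]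
    exact this.symm
  · obtain ⟨p, hp⟩ := hℓ ⟨x, hx⟩ (0, ⟨M, hM⟩, Y) (by
      refine Prod.ext ?_ (Prod.ext ?_ ?_)
      · ext j
        simp [Φ]
      · simpa [Φ] using hsM
      · ext Z
        exact hY Z)
    refine ⟨p.2.1, p.2.1.2, p.2.2, ?_, fun Z => ?_⟩
    · exact congrArg (fun q => q.2.1) hp
    · exact congrFun (congrArg (fun q => q.2.2) hp) Z

theorem Submodule.finrank_add_finrank_eq_comap_add_map [FiniteDimensional k A] (f : A →ₗ[k] A)
    (W E : Submodule k A) :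
    Module.finrank k W + Module.finrank k E =
      Module.finrank k ↥(W ⊓ E.comap f) + Module.finrank k ↥(W.map f ⊔ E) := by
  have h1 := Submodule.finrank_sup_add_finrank_inf_eq (W.map f) E
  have key : ∀ U : Submodule k A, Module.finrank k (U.map f) +
      Module.finrank k ↥(U ⊓ LinearMap.ker f) = Module.finrank k U := fun U => by
    have := (f.domRestrict U).finrank_range_add_finrank_ker
    rw [LinearMap.range_domRestrict, LinearMap.ker_domRestrict] at this
    rw [← this, ← Submodule.finrank_map_subtype_eq U (Submodule.comap U.subtype _),
      Submodule.map_comap_subtype]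
  have h2 := key W
  have h3 := key (W ⊓ E.comap f)
  have h4 : (W ⊓ E.comap f).map f = W.map f ⊓ E := Submodule.map_inf_eq_map_inf_comap.symm
  have h5 : W ⊓ E.comap f ⊓ LinearMap.ker f = W ⊓ LinearMap.ker f := by
    ext x
    simp only [Submodule.mem_inf, Submodule.mem_comap, LinearMap.mem_ker]
    constructor
    · rintro ⟨⟨h, -⟩, h'⟩
      exact ⟨h, h'⟩
    · rintro ⟨h, h'⟩
      exact ⟨⟨h, h' ▸ E.zero_mem⟩, h'⟩
  rw [h4, h5] at h3
  omega

theorem Submodule.mul_mem_pow_succ {V : Submodule k A} {i : ℕ} {x m : A} (hx : x ∈ V)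
    (hm : m ∈ V ^ i) : x * m ∈ V ^ (i + 1) := by
  rw [pow_succ']
  exact Submodule.mul_mem_mul hx hm

/-- The increasing filtration `N ≤ ℓ ^ d * V ^ 0 + N ≤ ℓ ^ (d - 1) * V ^ 1 + N ≤ ⋯`. -/
def powerFiltration (V N : Submodule k A) (ℓ : A) (d : ℕ) : ℕ → Submodule k A
  | 0 => N
  | i + 1 => (V ^ i).map (LinearMap.mulLeft k (ℓ ^ (d - i))) ⊔ N

/-- The degree-`i` forms that `ℓ ^ (d - i)` moves one step down in `powerFiltration`. -/
def residualPiece (V N : Submodule k A) (ℓ : A) (d i : ℕ) : Submodule k A :=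
  V ^ i ⊓ (powerFiltration V N ℓ d i).comap (LinearMap.mulLeft k (ℓ ^ (d - i)))

theorem mem_powerFiltration_succ {V N : Submodule k A} {ℓ : A} {d i : ℕ} {x : A} :
    x ∈ powerFiltration V N ℓ d (i + 1) ↔ ∃ m ∈ V ^ i, x - ℓ ^ (d - i) * m ∈ N := by
  simp only [powerFiltration, Submodule.mem_sup, Submodule.mem_map, LinearMap.mulLeft_apply]
  constructor
  · rintro ⟨_, ⟨m, hm, rfl⟩, z, hz, rfl⟩
    exact ⟨m, hm, by simpa using hz⟩
  · rintro ⟨m, hm, h⟩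
    exact ⟨_, ⟨m, hm, rfl⟩, _, h, by ring⟩

theorem mem_residualPiece {V N : Submodule k A} {ℓ : A} {d i : ℕ} {x : A} :
    x ∈ residualPiece V N ℓ d i ↔ x ∈ V ^ i ∧ ℓ ^ (d - i) * x ∈ powerFiltration V N ℓ d i := by
  simp [residualPiece]

theorem residualPiece_le (V N : Submodule k A) (ℓ : A) (d i : ℕ) :
    residualPiece V N ℓ d i ≤ V ^ i :=
  inf_le_left

theorem mul_residualPiece_le [CharZero k] {V N : Submodule k A} {ℓ : A} {B d : ℕ} (hℓ : ℓ ∈ V)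
    (hgen : ∀ i < B, ∀ e < B, ∀ n ∈ V ^ i, ℓ ^ e * n ∈ N → ∀ x ∈ V,
        ∃ m ∈ V ^ i, e * ℓ ^ (e - 1) * x * n - ℓ ^ e * m ∈ N) (hd : d < B) {i : ℕ} (hi : i < d) :
    V * residualPiece V N ℓ d i ≤ residualPiece V N ℓ d (i + 1) := by
  rw [Submodule.mul_le]
  intro x hx m hm
  rw [mem_residualPiece] at hm ⊢
  refine ⟨Submodule.mul_mem_pow_succ hx hm.1, ?_⟩
  have key : ∀ n ∈ V ^ i, ℓ ^ (d - i) * n ∈ N →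
      ℓ ^ (d - (i + 1)) * (x * n) ∈ powerFiltration V N ℓ d (i + 1) := fun n hn hnN => by
    obtain ⟨m', hm', h⟩ := hgen i (by omega) (d - i) (by omega) n hn hnN x hx
    have hne : ((d - i : ℕ) : k) ≠ 0 := Nat.cast_ne_zero.2 (by omega)
    have h2 : ((d - i : ℕ) : k) • (ℓ ^ (d - (i + 1)) * (x * n)) ∈
        powerFiltration V N ℓ d (i + 1) := by
      refine mem_powerFiltration_succ.2 ⟨m', hm', ?_⟩
      convert h using 2
      rw [Algebra.smul_def, map_natCast, Nat.sub_sub]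
      ring
    exact (Submodule.smul_mem_iff _ hne).1 h2
  cases i with
  | zero => exact key m hm.1 hm.2
  | succ j =>
    obtain ⟨m', hm', h⟩ := mem_powerFiltration_succ.1 hm.2
    have hp : ℓ ^ (d - j) = ℓ ^ (d - (j + 1)) * ℓ := by
      rw [← pow_succ]; congr 1; omega
    have h1 := key (m - ℓ * m') (sub_mem hm.1 (Submodule.mul_mem_pow_succ hℓ hm'))
      (by convert h using 1; rw [hp]; ring)
    have h2 : ℓ ^ (d - (j + 1)) * (x * m') ∈ powerFiltration V N ℓ d (j + 1 + 1) :=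
      mem_powerFiltration_succ.2
        ⟨x * m', Submodule.mul_mem_pow_succ hx hm', by simp⟩
    convert add_mem h1 h2 using 1
    have hp' : ℓ ^ (d - (j + 1)) = ℓ ^ (d - (j + 1 + 1)) * ℓ := by
      rw [← pow_succ]; congr 1; omega
    rw [hp']
    ring

theorem residualPiece_eq_pow_of_le {V N : Submodule k A} {ℓ : A} {d : ℕ}
    (hres : ∀ i < d, V * residualPiece V N ℓ d i ≤ residualPiece V N ℓ d (i + 1))
    {i j : ℕ} (hij : i ≤ j) (hj : j ≤ d) (h : residualPiece V N ℓ d i = V ^ i) :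
    residualPiece V N ℓ d j = V ^ j := by
  induction j, hij using Nat.le_induction with
  | base => exact h
  | succ j hij ih =>
    refine le_antisymm (residualPiece_le _ _ _ _ _) ?_
    rw [pow_succ', ← ih (by omega)]
    exact hres j (by omega)

variable [FiniteDimensional k A]

theorem sum_finrank_residualPiece_add {V N : Submodule k A} {ℓ : A} {d : ℕ} (hℓ : ℓ ∈ V) {j : ℕ}
    (hj : j ≤ d + 1) :
    ∑ i ∈ Finset.range j, (Module.finrank k ↥(V ^ i) - Module.finrank k (residualPiece V N ℓ d i)) +
      Module.finrank k N = Module.finrank k (powerFiltration V N ℓ d j) := by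
  induction j with
  | zero =>
    rw [Finset.sum_range_zero, zero_add]
    rfl
  | succ j ih =>
    have h1 := Submodule.finrank_add_finrank_eq_comap_add_map (LinearMap.mulLeft k (ℓ ^ (d - j)))
      (V ^ j) (powerFiltration V N ℓ d j)
    have h2 : (V ^ j).map (LinearMap.mulLeft k (ℓ ^ (d - j))) ⊔ powerFiltration V N ℓ d j =
        powerFiltration V N ℓ d (j + 1) := by
      cases j with
      | zero => rfl
      | succ i =>
        simp only [powerFiltration]
        rw [← sup_assoc]
        congr 1
        refine sup_eq_left.2 ?_
        rintro _ ⟨m, hm, rfl⟩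
        refine ⟨ℓ * m, Submodule.mul_mem_pow_succ hℓ hm, ?_⟩
        have hp : ℓ ^ (d - i) = ℓ ^ (d - (i + 1)) * ℓ := by
          rw [← pow_succ]; congr 1; omega
        simp only [LinearMap.mulLeft_apply, hp]
        ring
    rw [h2] at h1
    change _ = Module.finrank k (residualPiece V N ℓ d j) + _ at h1
    have h3 := Submodule.finrank_mono (residualPiece_le V N ℓ d j)
    rw [Finset.sum_range_succ]
    have := ih (by omega)
    omega

theorem sum_finrank_residualPiece {V N : Submodule k A} {ℓ : A} {d : ℕ} (hℓ : ℓ ∈ V)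
    (hN : N ≤ V ^ d) :
    ∑ i ∈ Finset.range (d + 1),
      (Module.finrank k ↥(V ^ i) - Module.finrank k (residualPiece V N ℓ d i)) +
      Module.finrank k N = Module.finrank k ↥(V ^ d) := by
  rw [sum_finrank_residualPiece_add hℓ le_rfl]
  have : powerFiltration V N ℓ d (d + 1) = V ^ d := by
    simp only [powerFiltration, Nat.sub_self, pow_zero, LinearMap.mulLeft_one, Submodule.map_id]
    exact sup_eq_left.2 hN
  rw [this]

/-- Macaulay's bound: a Hilbert function which is at most `d` in degree `d` cannot increase
afterwards. -/
theorem finrank_pow_succ_sub_le [CharZero k] {V : Submodule k A} {N : ℕ → Submodule k A}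
    {d : ℕ} (hd : d ≠ 0) (hN : N d ≤ V ^ d) (hmul : V * N d ≤ N (d + 1))
    (hN' : N (d + 1) ≤ V ^ (d + 1))
    (h : Module.finrank k ↥(V ^ d) - Module.finrank k (N d) ≤ d) :
    Module.finrank k ↥(V ^ (d + 1)) - Module.finrank k (N (d + 1)) ≤
      Module.finrank k ↥(V ^ d) - Module.finrank k (N d) := by
  have : Infinite k := Infinite.of_injective _ (Nat.cast_injective (R := k))
  obtain ⟨ℓ, hℓ, hgen, -⟩ := exists_general_element V (N d) (d + 1) 0
  have hres : ∀ i < d, V * residualPiece V (N d) ℓ d i ≤ residualPiece V (N d) ℓ d (i + 1) :=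
    fun i hi => mul_residualPiece_le hℓ hgen (Nat.lt_succ_self d) hi
  have hsum := sum_finrank_residualPiece hℓ hN
  obtain ⟨i, hi, hi0⟩ : ∃ i ≤ d, residualPiece V (N d) ℓ d i = V ^ i := by
    by_contra! hne
    have h1 : ∑ i ∈ Finset.range (d + 1), 1 ≤ ∑ i ∈ Finset.range (d + 1),
        (Module.finrank k ↥(V ^ i) - Module.finrank k (residualPiece V (N d) ℓ d i)) := by
      refine Finset.sum_le_sum fun i hi => ?_
      have := Submodule.finrank_lt_finrank_of_lt
        (lt_of_le_of_ne (residualPiece_le V (N d) ℓ d i) (hne i (Finset.mem_range_succ_iff.1 hi)))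
      omega
    simp only [Finset.sum_const, Finset.card_range, smul_eq_mul, mul_one] at h1
    omega
  have htop := residualPiece_eq_pow_of_le hres hi le_rfl hi0
  obtain ⟨d, rfl⟩ := Nat.exists_eq_succ_of_ne_zero hd
  have hsurj : V ^ (d + 1 + 1) ≤ (V ^ (d + 1)).map (LinearMap.mulLeft k ℓ) ⊔ N (d + 1 + 1) := by
    rw [pow_succ', Submodule.mul_le]
    intro x hx m hm
    have hm' : m ∈ residualPiece V (N (d + 1)) ℓ (d + 1) (d + 1) := htop ▸ hm
    obtain ⟨m', hm', hz⟩ := mem_powerFiltration_succ.1 (mem_residualPiece.1 hm').2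
    simp only [Nat.sub_self, pow_zero, one_mul, Nat.add_sub_cancel_left, pow_one] at hz
    refine Submodule.mem_sup.2 ⟨ℓ * (x * m'), ⟨x * m', Submodule.mul_mem_pow_succ hx hm', rfl⟩,
      x * (m - ℓ * m'), hmul (Submodule.mul_mem_mul hx hz), by ring⟩
  have h1 := Submodule.finrank_add_finrank_eq_comap_add_map (LinearMap.mulLeft k ℓ)
    (V ^ (d + 1)) (N (d + 1 + 1))
  have h2 := Submodule.finrank_mono hsurj
  have h3 : N (d + 1) ≤ V ^ (d + 1) ⊓ (N (d + 1 + 1)).comap (LinearMap.mulLeft k ℓ) :=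
    le_inf hN fun z hz => hmul (Submodule.mul_mem_mul hℓ hz)
  have h4 := Submodule.finrank_mono h3
  have h5 := Submodule.finrank_mono hN
  have h6 := Submodule.finrank_mono hN'
  simp only [Nat.succ_eq_add_one] at *
  omega

omit [FiniteDimensional k A] in
theorem eq_zero_of_forall_mul_eq_zero {V : Submodule k A} {e : ℕ}
    (hsoc : ∀ i < e, ∀ x ∈ V ^ i, (∀ v ∈ V, v * x = 0) → x = 0) {n i : ℕ} (hi : i + n = e) {x : A}
    (hx : x ∈ V ^ i) (h : ∀ y ∈ V ^ n, y * x = 0) : x = 0 := by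
  induction n generalizing i x with
  | zero => simpa using h 1 (by simp [Submodule.one_le.1 le_rfl])
  | succ n ih =>
    refine hsoc i (by omega) x hx fun v hv => ?_
    refine ih (i := i + 1) (by omega) (Submodule.mul_mem_pow_succ hv hx) fun y hy => ?_
    rw [← mul_assoc, mul_comm y v]
    exact h _ (Submodule.mul_mem_pow_succ hv hy)

/-- In a Gorenstein algebra, the rank of multiplication by a linear form is at most its rank in the
complementary degree. -/
theorem finrank_map_mulLeft_le_of_socle {V : Submodule k A} {e : ℕ}
    (hsoc : ∀ i < e, ∀ x ∈ V ^ i, (∀ v ∈ V, v * x = 0) → x = 0)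
    (he : Module.finrank k ↥(V ^ e) = 1) {ℓ : A} (hℓ : ℓ ∈ V) {i j : ℕ} (hij : i + (j + 1) = e) :
    Module.finrank k ((V ^ j).map (LinearMap.mulLeft k ℓ)) ≤
      Module.finrank k ((V ^ i).map (LinearMap.mulLeft k ℓ)) := by
  let eqv : ↥(V ^ e) ≃ₗ[k] k := LinearEquiv.ofFinrankEq _ _ (by simp [he])
  obtain ⟨φ, hφ⟩ := LinearMap.exists_extend eqv.toLinearMap
  have hφ0 : ∀ x ∈ V ^ e, φ x = 0 → x = 0 := fun x hx h => by
    have : eqv ⟨x, hx⟩ = 0 := by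
      rw [← h]
      exact (LinearMap.congr_fun hφ ⟨x, hx⟩).symm
    simpa using this
  set S := (V ^ j).map (LinearMap.mulLeft k ℓ) with hS
  let T : S →ₗ[k] Module.Dual k ↥(V ^ i) :=
    ((LinearMap.mul k A).compr₂ φ).domRestrict₁₂ S (V ^ i)
  have hT : ∀ w x, T w x = φ (w * x) := fun w x => rfl
  let K := LinearMap.ker ((LinearMap.mulLeft k ℓ).domRestrict (V ^ i))
  have hker : LinearMap.ker T = ⊥ := by
    refine LinearMap.ker_eq_bot'.2 fun w hw => ?_
    obtain ⟨_, ⟨m, hm, rfl⟩⟩ := w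
    refine Subtype.ext ?_
    have hmem : ℓ * m ∈ V ^ (j + 1) := Submodule.mul_mem_pow_succ hℓ hm
    refine eq_zero_of_forall_mul_eq_zero hsoc (i := j + 1) (n := i) (by omega) hmem fun y hy => ?_
    refine hφ0 _ ?_ ?_
    · rw [← hij, pow_add]
      exact Submodule.mul_mem_mul hy hmem
    · rw [mul_comm]
      exact LinearMap.congr_fun hw ⟨y, hy⟩
  have hrange : LinearMap.range T ≤ K.dualAnnihilator := by
    rintro _ ⟨w, rfl⟩
    rw [Submodule.mem_dualAnnihilator]
    intro x hx
    obtain ⟨_, ⟨m, hm, rfl⟩⟩ := w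
    have hx' : ℓ * (x : A) = 0 := hx
    rw [hT]
    simp only [LinearMap.mulLeft_apply]
    rw [mul_right_comm, hx', zero_mul, map_zero]
  have h1 := Submodule.finrank_mono hrange
  have h2 := T.finrank_range_add_finrank_ker
  have h3 := ((LinearMap.mulLeft k ℓ).domRestrict (V ^ i)).finrank_range_add_finrank_ker
  have h4 := Subspace.finrank_add_finrank_dualAnnihilator_eq K
  rw [hker, finrank_bot] at h2
  rw [LinearMap.range_domRestrict] at h3
  change _ + Module.finrank k K = _ at h3
  omega

omit [FiniteDimensional k A] in
theorem sq_le_of_le_sup_span {V W F : Submodule k A} {p q : A} (hVW : V * W ≤ F)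
    (hV : V ≤ W ⊔ k ∙ p ⊔ k ∙ q) (hpV : p ∈ V) (hqV : q ∈ V) (hpp : p * p ∈ F)
    (hpq : p * q ∈ F) (hqq : q * q ∈ F) : V ^ 2 ≤ F := by
  have key : ∀ z ∈ V, z * p ∈ F → z * q ∈ F → ∀ y ∈ V, z * y ∈ F := fun z hz hzp hzq y hy => by
    obtain ⟨_, hu, _, hb, rfl⟩ := Submodule.mem_sup.1 (hV hy)
    obtain ⟨w, hw, _, ha, rfl⟩ := Submodule.mem_sup.1 hu
    obtain ⟨a, rfl⟩ := Submodule.mem_span_singleton.1 ha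
    obtain ⟨b, rfl⟩ := Submodule.mem_span_singleton.1 hb
    rw [mul_add, mul_add, mul_smul_comm, mul_smul_comm]
    exact add_mem (add_mem (hVW (Submodule.mul_mem_mul hz hw)) (F.smul_mem _ hzp))
      (F.smul_mem _ hzq)
  rw [pow_two, Submodule.mul_le]
  intro x hx y hy
  refine key x hx ?_ ?_ y hy
  · rw [mul_comm]
    exact key p hpV hpp hpq x hx
  · rw [mul_comm]
    exact key q hqV (by rwa [mul_comm]) hqq x hx

theorem finrank_add_one_le_of_notMem {W : Submodule k A} {p : A} (hp : p ∉ W) :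
    Module.finrank k W + 1 ≤ Module.finrank k ↥(W ⊔ k ∙ p) := by
  refine Submodule.finrank_lt_finrank_of_lt (lt_of_le_of_ne le_sup_left fun h => hp ?_)
  rw [h]
  exact Submodule.mem_sup_right (Submodule.mem_span_singleton_self p)

theorem finrank_sup_span_singleton_le (W : Submodule k A) (p : A) :
    Module.finrank k ↥(W ⊔ k ∙ p) ≤ Module.finrank k W + 1 :=
  (Submodule.finrank_add_le_finrank_add_finrank _ _).trans
    (Nat.add_le_add_left (by
      simpa using finrank_span_le_card (R := k) ({p} : Set A)) _)

/-- If `W` has codimension at most two in `V` and the products of `V` with `W` span a subspace of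
codimension at least three in `V ^ 2`, then `V / W` has no zero divisors modulo that subspace. -/
theorem mem_of_mul_mem {V W E : Submodule k A} (hWV : W ≤ V)
    (hdim : Module.finrank k V ≤ Module.finrank k W + 2) (hVW : V * W ≤ E)
    (hdim' : Module.finrank k E + 3 ≤ Module.finrank k ↥(V ^ 2)) {x y : A} (hx : x ∈ V)
    (hxW : x ∉ W) (hy : y ∈ V) (hxy : x * y ∈ E) : y ∈ W := by
  have two : ∀ z ∈ V, z ∉ W ⊔ k ∙ x → V ≤ W ⊔ k ∙ x ⊔ k ∙ z := fun z hz hzW => by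
    refine (Submodule.eq_of_le_of_finrank_le ?_ ?_).ge
    · refine sup_le (sup_le hWV ?_) ?_ <;> simpa [Submodule.span_le]
    · have h1 := finrank_add_one_le_of_notMem hxW
      have h2 := finrank_add_one_le_of_notMem hzW
      omega
  have bound : ∀ s t : A, ¬ V ^ 2 ≤ E ⊔ k ∙ s ⊔ k ∙ t := fun s t h => by
    have h1 := Submodule.finrank_mono h
    have h2 := finrank_sup_span_singleton_le (E ⊔ k ∙ s) t
    have h3 := finrank_sup_span_singleton_le E s
    omega
  have memE : ∀ s t : A, ∀ z ∈ E, z ∈ E ⊔ k ∙ s ⊔ k ∙ t := fun s t z hz =>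
    Submodule.mem_sup_left (Submodule.mem_sup_left hz)
  have memS : ∀ s t : A, s ∈ E ⊔ k ∙ s ⊔ k ∙ t := fun s t =>
    Submodule.mem_sup_left (Submodule.mem_sup_right (Submodule.mem_span_singleton_self s))
  have memT : ∀ s t : A, t ∈ E ⊔ k ∙ s ⊔ k ∙ t := fun s t =>
    Submodule.mem_sup_right (Submodule.mem_span_singleton_self t)
  by_contra hyW
  by_cases hy' : y ∈ W ⊔ k ∙ x
  · obtain ⟨w, hw, _, hc, rfl⟩ := Submodule.mem_sup.1 hy'
    obtain ⟨c, rfl⟩ := Submodule.mem_span_singleton.1 hc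
    have hc0 : c ≠ 0 := by
      rintro rfl
      simp [hw] at hyW
    have hxx : x * x ∈ E := by
      have h1 : c • (x * x) ∈ E := by
        have := sub_mem hxy (hVW (Submodule.mul_mem_mul hx hw))
        rwa [mul_add, add_sub_cancel_left, mul_smul_comm] at this
      exact (Submodule.smul_mem_iff _ hc0).1 h1
    by_cases hV : V ≤ W ⊔ k ∙ x
    · exact bound x x (sq_le_of_le_sup_span (hVW.trans (memE x x))
        (hV.trans le_sup_left) hx hx (memE _ _ _ hxx) (memE _ _ _ hxx) (memE _ _ _ hxx))
    · obtain ⟨z, hz, hzW⟩ := SetLike.not_le_iff_exists.1 hV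
      exact bound (x * z) (z * z) (sq_le_of_le_sup_span (hVW.trans (memE _ _))
        (two z hz hzW) hx hz (memE _ _ _ hxx) (memS _ _) (memT _ _))
  · exact bound (x * x) (y * y) (sq_le_of_le_sup_span (hVW.trans (memE _ _))
      (two y hy hy') hx hy (memS _ _) (memE _ _ _ hxy) (memT _ _))

omit [FiniteDimensional k A] in
/-- If `M * V ≤ ℓ * V`, then multiplication by `M` on `V` factors through multiplication by `ℓ`. -/
theorem exists_linearMap_mul_eq {V : Submodule k A} {ℓ M : A}
    (h : ∀ z ∈ V, M * z ∈ V.map (LinearMap.mulLeft k ℓ)) :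
    ∃ Y : V →ₗ[k] V, ∀ Z : V, M * Z = ℓ * Y Z := by
  let f : V →ₗ[k] V.map (LinearMap.mulLeft k ℓ) :=
    ((LinearMap.mulLeft k ℓ).domRestrict V).codRestrict _ fun c => ⟨c, c.2, rfl⟩
  let g : V →ₗ[k] V.map (LinearMap.mulLeft k ℓ) :=
    ((LinearMap.mulLeft k M).domRestrict V).codRestrict _ fun c => h c c.2
  have hf : Function.Surjective f := by
    rintro ⟨_, ⟨y, hy, rfl⟩⟩
    exact ⟨⟨y, hy⟩, rfl⟩
  obtain ⟨Y, hY⟩ := Module.projective_lifting_property f g hf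
  exact ⟨Y, fun Z => (congrArg Subtype.val (LinearMap.congr_fun hY Z)).symm⟩

omit [FiniteDimensional k A] in
/-- A subspace `U` of `V` killed by `ℓ ^ n` with `U * V ≤ ℓ * U` vanishes. -/
theorem eq_bot_of_mul_le_map_mulLeft {V U : Submodule k A} {ℓ : A} {n : ℕ}
    (hsoc : ∀ i < n + 2, ∀ x ∈ V ^ i, (∀ v ∈ V, v * x = 0) → x = 0) (hUV : U ≤ V)
    (hU : ∀ u ∈ U, ℓ ^ n * u = 0) (hUU : ∀ u ∈ U, ∀ x ∈ V, ∃ y ∈ U, x * u = ℓ * y) : U = ⊥ := by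
  have key : ∀ j, ∀ z ∈ V ^ j, ∀ u ∈ U, ∃ y ∈ U, z * u = ℓ ^ j * y := by
    intro j
    induction j with
    | zero =>
      intro z hz u hu
      rw [pow_zero, Submodule.mem_one] at hz
      obtain ⟨c, rfl⟩ := hz
      exact ⟨c • u, U.smul_mem c hu, by rw [pow_zero, one_mul, Algebra.smul_def]⟩
    | succ j ih =>
      intro z hz u hu
      rw [pow_succ'] at hz
      induction hz using Submodule.mul_induction_on' with
      | mem_mul_mem x hx m hm =>
        obtain ⟨y, hy, h1⟩ := ih m hm u hu
        obtain ⟨y', hy', h2⟩ := hUU y hy x hx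
        refine ⟨y', hy', ?_⟩
        rw [mul_assoc, h1, mul_left_comm, h2, pow_succ, mul_assoc]
      | add x _ y _ hx hy =>
        obtain ⟨a, ha, h1⟩ := hx
        obtain ⟨b, hb, h2⟩ := hy
        exact ⟨a + b, add_mem ha hb, by rw [add_mul, h1, h2, mul_add]⟩
  refine (Submodule.eq_bot_iff _).2 fun u hu => ?_
  refine eq_zero_of_forall_mul_eq_zero hsoc (i := 1) (n := n + 1) (by omega)
    (by rw [pow_one]; exact hUV hu) fun y hy => ?_
  rw [pow_succ'] at hy
  induction hy using Submodule.mul_induction_on' with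
  | mem_mul_mem x hx m hm =>
    obtain ⟨y, hy, h1⟩ := key n m hm u hu
    rw [mul_assoc, h1, hU y hy, mul_zero]
  | add x _ y _ hx hy => rw [add_mul, hx, hy, add_zero]

/-- The numerical consequences of Green's restriction theorem and Macaulay's bound for a Gorenstein
algebra with Hilbert function `(1, 18, a, t, a, 18, 1)`, `a < 18`. -/
theorem finrank_residualPiece_of_lt [CharZero k] {V : Submodule k A}
    (hsoc : ∀ i < 6, ∀ x ∈ V ^ i, (∀ v ∈ V, v * x = 0) → x = 0)
    (h0 : Module.finrank k ↥(V ^ 0) = 1) (h1 : Module.finrank k ↥(V ^ 1) = 18)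
    (h5 : Module.finrank k ↥(V ^ 5) = 18) (h6 : Module.finrank k ↥(V ^ 6) = 1)
    (ha : Module.finrank k ↥(V ^ 2) < 18) {ℓ : A} (hℓ : ℓ ∈ V)
    (hres : ∀ i < 5, V * residualPiece V ⊥ ℓ 5 i ≤ residualPiece V ⊥ ℓ 5 (i + 1)) :
    residualPiece V ⊥ ℓ 5 0 = ⊥ ∧ Module.finrank k (residualPiece V ⊥ ℓ 5 1) = 16 ∧
      residualPiece V ⊥ ℓ 5 2 = V.map (LinearMap.mulLeft k ℓ) ∧
      Module.finrank k (V.map (LinearMap.mulLeft k ℓ)) = 14 ∧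
      Module.finrank k ↥(V ^ 2) = 17 := by
  let c : ℕ → ℕ := fun i =>
    Module.finrank k ↥(V ^ i) - Module.finrank k (residualPiece V ⊥ ℓ 5 i)
  have hc : ∀ i, c i + Module.finrank k (residualPiece V ⊥ ℓ 5 i) = Module.finrank k ↥(V ^ i) :=
    fun i => Nat.sub_add_cancel (Submodule.finrank_mono (residualPiece_le V ⊥ ℓ 5 i))
  have hsum : ∑ i ∈ Finset.range 6, c i + Module.finrank k (⊥ : Submodule k A) =
      Module.finrank k ↥(V ^ 5) := sum_finrank_residualPiece hℓ bot_le
  have mac : ∀ d < 5, d ≠ 0 → c d ≤ d → c (d + 1) ≤ c d := fun d hd hd0 =>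
    finrank_pow_succ_sub_le (N := residualPiece V ⊥ ℓ 5) hd0 (residualPiece_le _ _ _ _ _)
      (hres d hd) (residualPiece_le _ _ _ _ _)
  have m1 : c 1 ≤ 1 → c 2 ≤ c 1 := mac 1 (by norm_num) (by norm_num)
  have m2 : c 2 ≤ 2 → c 3 ≤ c 2 := mac 2 (by norm_num) (by norm_num)
  have m3 : c 3 ≤ 3 → c 4 ≤ c 3 := mac 3 (by norm_num) (by norm_num)
  have m4 : c 4 ≤ 4 → c 5 ≤ c 4 := mac 4 (by norm_num) (by norm_num)
  have hc2 : V.map (LinearMap.mulLeft k ℓ) ≤ residualPiece V ⊥ ℓ 5 2 := by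
    rintro _ ⟨v, hv, rfl⟩
    refine mem_residualPiece.2 ⟨Submodule.mul_mem_pow_succ hℓ (by rwa [pow_one]), ?_⟩
    refine mem_powerFiltration_succ.2 ⟨v, by rwa [pow_one], ?_⟩
    rw [Submodule.mem_bot, LinearMap.mulLeft_apply]
    ring
  have hc5 : residualPiece V ⊥ ℓ 5 5 ≤ (V ^ 4).map (LinearMap.mulLeft k ℓ) := by
    intro x hx
    obtain ⟨m, hm, h⟩ := mem_powerFiltration_succ.1 (mem_residualPiece.1 hx).2
    refine ⟨m, hm, ?_⟩
    rw [Submodule.mem_bot, sub_eq_zero] at h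
    simpa using h.symm
  have hd := finrank_map_mulLeft_le_of_socle hsoc h6 hℓ (i := 1) (j := 4) rfl
  rw [pow_one] at hd
  have h2 := Submodule.finrank_mono hc2
  have h55 := Submodule.finrank_mono hc5
  have l0 := hc 0
  have l1 := hc 1
  have l2 := hc 2
  have l5 := hc 5
  have hc0 : Module.finrank k (residualPiece V ⊥ ℓ 5 0) ≠ 1 := fun h => by
    have h' := residualPiece_eq_pow_of_le hres (Nat.zero_le 5) le_rfl
      (Submodule.eq_of_le_of_finrank_le (residualPiece_le V ⊥ ℓ 5 0) (by rw [h0, h]))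
    have := congrArg (fun S : Submodule k A => Module.finrank k S) h'
    simp only [h5] at this
    omega
  simp only [Finset.sum_range_succ, Finset.sum_range_zero, finrank_bot] at hsum
  refine ⟨Submodule.finrank_eq_zero.1 (by omega), by omega,
    (Submodule.eq_of_le_of_finrank_le hc2 (by omega)).symm, by omega, by omega⟩

/-- An algebra with symmetric Hilbert function `(1, 18, a, t, a, 18, 1)` and no socle below degree
`6` has `a ≥ 18`. -/
theorem le_finrank_sq_of_socle [CharZero k] {V : Submodule k A}
    (hsoc : ∀ i < 6, ∀ x ∈ V ^ i, (∀ v ∈ V, v * x = 0) → x = 0)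
    (h0 : Module.finrank k ↥(V ^ 0) = 1) (h1 : Module.finrank k ↥(V ^ 1) = 18)
    (h5 : Module.finrank k ↥(V ^ 5) = 18) (h6 : Module.finrank k ↥(V ^ 6) = 1) :
    18 ≤ Module.finrank k ↥(V ^ 2) := by
  by_contra! ha
  have : Infinite k := Infinite.of_injective _ (Nat.cast_injective (R := k))
  obtain ⟨L, hL, hgen, hgen'⟩ := exists_general_element V ⊥ 7 4
  have hres : ∀ i < 5, V * residualPiece V ⊥ L 5 i ≤ residualPiece V ⊥ L 5 (i + 1) :=
    fun i hi => mul_residualPiece_le hL hgen (by norm_num) hi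
  obtain ⟨hr0, hr1, hr2, hLV, hV2⟩ := finrank_residualPiece_of_lt hsoc h0 h1 h5 h6 ha hL hres
  set W := residualPiece V ⊥ L 5 1 with hW
  set E := V.map (LinearMap.mulLeft k L) with hE
  have natCast_mul_eq_zero : ∀ n : ℕ, n ≠ 0 → ∀ x : A, (n : A) * x = 0 → x = 0 := by
    intro n hn x hx
    have h : (n : k) • x = 0 := by rwa [Algebra.smul_def, map_natCast]
    exact (smul_eq_zero.1 h).resolve_left (Nat.cast_ne_zero.2 hn)
  have hL5 : L ^ 5 ≠ 0 := fun h => by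
    have h1mem : (1 : A) ∈ residualPiece V ⊥ L 5 0 :=
      mem_residualPiece.2 ⟨by simp [Submodule.one_le.1 le_rfl], by simp [powerFiltration, h]⟩
    rw [hr0, Submodule.mem_bot] at h1mem
    have : Subsingleton A := subsingleton_of_zero_eq_one h1mem.symm
    rw [Module.finrank_zero_of_subsingleton] at h0
    omega
  have hL6 : L ^ 6 ≠ 0 := fun h => by
    refine hL5 (hsoc 5 (by norm_num) _ (Submodule.pow_mem_pow V hL 5) fun v hv => ?_)
    obtain ⟨m, -, hm⟩ := hgen 0 (by norm_num) 6 (by norm_num) 1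
      (by simp [Submodule.one_le.1 le_rfl]) (by simp [h]) v hv
    refine natCast_mul_eq_zero 6 (by norm_num) _ ?_
    rw [Submodule.mem_bot, h] at hm
    norm_num at hm ⊢
    rw [← hm]
    ring
  have hWV : W ≤ V := (residualPiece_le V ⊥ L 5 1).trans_eq (pow_one V)
  have hVW : V * W ≤ E := hr2 ▸ hres 1 (by norm_num)
  let U := V ⊓ LinearMap.ker (LinearMap.mulLeft k (L ^ 4))
  have memU : ∀ {u}, u ∈ U ↔ u ∈ V ∧ L ^ 4 * u = 0 := by
    intro u
    simp [U]
  have hUW : U ≤ W := fun u hu => mem_residualPiece.2 ⟨by rw [pow_one]; exact (memU.1 hu).1,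
    by simp [(memU.1 hu).2]⟩
  have hWU : ∀ w ∈ W, ∃ c : k, w - c • L ∈ U := fun w hw => by
    obtain ⟨m, hm, h⟩ := mem_powerFiltration_succ.1 (mem_residualPiece.1 hw).2
    rw [pow_zero, Submodule.mem_one] at hm
    obtain ⟨c, rfl⟩ := hm
    refine ⟨c, memU.2 ⟨sub_mem (hWV hw) (V.smul_mem c hL), ?_⟩⟩
    rw [Submodule.mem_bot] at h
    rw [← h, Algebra.smul_def]
    ring
  have cancel : ∀ x ∈ V, x ∉ W → ∀ y ∈ V, x * y ∈ E → y ∈ W := fun x hx hxW y hy hxy =>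
    mem_of_mul_mem hWV (by rw [hr1, ← h1.trans (by norm_num : 18 = 16 + 2), pow_one]) hVW (by omega)
      hx hxW hy hxy
  have kill : ∀ M ∈ U, ∀ x ∈ V, x ∉ W → L ^ 3 * M * x = 0 := fun M hM x hx hxW => by
    obtain ⟨Y, hY⟩ := exists_linearMap_mul_eq (V := V) (ℓ := L) (M := M) fun z hz => by
      rw [mul_comm]
      exact hVW (Submodule.mul_mem_mul hz (hUW hM))
    obtain ⟨M', hM', Y', h1', h2'⟩ := hgen' M (memU.1 hM).1 Y (memU.1 hM).2
      (fun Z => by rw [hY, sub_self]) x hx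
    have hY0 := hY ⟨x, hx⟩
    have hY0' := h2' ⟨x, hx⟩
    generalize Y ⟨x, hx⟩ = y at hY0 hY0'
    generalize Y' ⟨x, hx⟩ = y' at hY0'
    obtain ⟨y, hyV⟩ := y
    obtain ⟨y', hyV'⟩ := y'
    simp only at hY0 hY0'
    have hu : M' - (4 : k) • y ∈ U := by
      refine memU.2 ⟨sub_mem hM' (V.smul_mem _ hyV), ?_⟩
      rw [Algebra.smul_def, map_ofNat]
      push_cast at h1'
      linear_combination h1' + 4 * L ^ 3 * hY0
    have h5xy : (5 : k) • (x * y) ∈ E := by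
      have e1 := hVW (Submodule.mul_mem_mul hx (hUW hu))
      have e2 : L * y' ∈ E := ⟨y', hyV', rfl⟩
      convert sub_mem e2 e1 using 1
      rw [Algebra.smul_def, Algebra.smul_def, map_ofNat, map_ofNat]
      linear_combination hY0'
    have hyW := cancel x hx hxW y hyV
      ((Submodule.smul_mem_iff _ (by norm_num : (5 : k) ≠ 0)).1 h5xy)
    obtain ⟨c, hc⟩ := hWU y hyW
    have hc4 := (memU.1 hc).2
    have hM4 := (memU.1 hM).2
    have hc6 : c • L ^ 6 = 0 := by
      rw [Algebra.smul_def] at hc4 ⊢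
      linear_combination x * hM4 - L ^ 4 * hY0 - L * hc4
    have hc0 := (smul_eq_zero.1 hc6).resolve_right hL6
    rw [hc0, zero_smul, sub_zero] at hc4
    linear_combination L ^ 3 * hY0 + hc4
  obtain ⟨x₀, hx₀, hx₀W⟩ : ∃ x ∈ V, x ∉ W := by
    by_contra! h
    have := Submodule.finrank_mono h
    rw [hr1, ← pow_one V, h1] at this
    omega
  have kill' : ∀ M ∈ U, ∀ x ∈ V, L ^ 3 * M * x = 0 := fun M hM x hx => by
    by_cases hxW : x ∈ W
    · have e1 := kill M hM x₀ hx₀ hx₀W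
      have e2 := kill M hM (x + x₀) (add_mem hx hx₀) fun h => hx₀W ((add_mem_cancel_left hxW).1 h)
      linear_combination e2 - e1
    · exact kill M hM x hx hxW
  have hU : U = ⊥ := by
    refine eq_bot_of_mul_le_map_mulLeft (n := 4) hsoc inf_le_left (fun u hu => (memU.1 hu).2)
      fun u hu x hx => ?_
    obtain ⟨y, hy, h⟩ := hVW (Submodule.mul_mem_mul hx (hUW hu))
    rw [LinearMap.mulLeft_apply] at h
    refine ⟨y, memU.2 ⟨hy, ?_⟩, h.symm⟩
    linear_combination L ^ 3 * h + kill' u hu x hx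
  have hWL : W ≤ k ∙ L := fun w hw => by
    obtain ⟨c, hc⟩ := hWU w hw
    rw [hU, Submodule.mem_bot, sub_eq_zero] at hc
    exact Submodule.mem_span_singleton.2 ⟨c, hc.symm⟩
  have := Submodule.finrank_mono hWL
  have h' : Module.finrank k ↥(k ∙ L) ≤ 1 := by
    simpa using finrank_span_le_card (R := k) ({L} : Set A)
  omega
end

theorem gradedPiece_eq_pow (k : Type*) [Field k] (r : ℕ) (I : Ideal (MvPolynomial (Fin r) k))
    (d : ℕ) : gradedPiece k r I d = gradedPiece k r I 1 ^ d := by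
  rw [gradedPiece, gradedPiece, ← Submodule.map_pow, homogeneousSubmodule_one_pow]

theorem eq_zero_of_socDim_eq_zero {k : Type*} [Field k] {r : ℕ}
    {I : Ideal (MvPolynomial (Fin r) k)} [Module.Finite k (MvPolynomial (Fin r) k ⧸ I)] {i : ℕ}
    (h : socDim k r I i = 0) {x : MvPolynomial (Fin r) k ⧸ I} (hx : x ∈ gradedPiece k r I i)
    (hxv : ∀ v ∈ gradedPiece k r I 1, v * x = 0) : x = 0 := by
  rw [socDim, Submodule.finrank_eq_zero] at h
  rw [← Submodule.mem_bot k, ← h]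
  obtain ⟨f, hf, rfl⟩ := hx
  refine ⟨f, ⟨hf, Submodule.mem_iInf _ |>.2 fun j => ?_⟩, rfl⟩
  refine Ideal.Quotient.eq_zero_iff_mem.1 ?_
  rw [LinearMap.mulLeft_apply, map_mul]
  exact hxv _ ⟨X j, isHomogeneous_X k j, rfl⟩

/-- Proposition 3.9 (ii): in characteristic zero, if `(1, 18, a, t, a, 18, 1)`
is a Gorenstein `h`-vector, then `a ≥ 18`. -/
theorem gorenstein_1_18_a_t_a_18_1
    (k : Type*) [Field k] [Infinite k] [CharZero k]
    (r a t : ℕ)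
    (I : Ideal (MvPolynomial (Fin r) k))
    (hlin : NoLinearForms I) (hGor : Gorenstein k r 6 I)
    (h0 : hilb k r I 0 = 1) (h1 : hilb k r I 1 = 18) (h2 : hilb k r I 2 = a)
    (h3 : hilb k r I 3 = t) (h4 : hilb k r I 4 = a) (h5 : hilb k r I 5 = 18)
    (h6 : hilb k r I 6 = 1) :
    18 ≤ a := by
  obtain ⟨⟨-, hfin⟩, -, hsoc, -⟩ := hGor
  have hp := gradedPiece_eq_pow k r I
  simp only [hilb] at h0 h1 h2 h5 h6
  rw [hp] at h0 h1 h2 h5 h6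
  rw [← h2]
  refine le_finrank_sq_of_socle (fun i hi x hx hxv => ?_) h0 h1 h5 h6
  exact eq_zero_of_socDim_eq_zero (hsoc i hi) (by rwa [hp]) hxv
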